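/- arXiv:2403.19177 — 2 statements merged into one kernel-verified Lean document; each statement's English description precedes it below -/
import Mathlib

section
/- Han's inequality (Theorem 1 of the paper, averaged form): Let X = (X_1, ..., X_i) be a tuple of discrete random variables on a probability space, each taking values in a finite set. For 1 ≤ k ≤ i define the average entropy over k-element subsets H̄^k(X) = (1 / C(i,k)) · Σ_{T ⊆ {1,...,i}, |T| = k} H(X_T), where X_T denotes the subtuple of X indexed by T and C(i,k) is the binomial coefficient. Then (1/k) · H̄^k(X) is non-increasing in k: for all 1 ≤ k ≤ m ≤ i, (1/m) · H̄^m(X) ≤ (1/k) · H̄^k(X). -/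
open MeasureTheory Real

/-- Shannon entropy of a random variable with values in a finite type,
with the convention `0 * log 0 = 0` (automatic since `Real.log 0 = 0`). -/
noncomputable def shannonEntropy {Ω : Type*} [MeasurableSpace Ω] (μ : Measure Ω)
    {S : Type*} [Fintype S] (X : Ω → S) : ℝ :=
  - ∑ s : S, (μ (X ⁻¹' {s})).toReal * Real.log (μ (X ⁻¹' {s})).toReal

/-- `H̄^k(X)`: the average joint entropy over all `k`-element subsets of the `i` coordinates. -/
noncomputable def avgEntropy {Ω : Type*} [MeasurableSpace Ω] (μ : Measure Ω)
    {i : ℕ} {S : Fin i → Type*} [∀ j, Fintype (S j)]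
    (X : ∀ j, Ω → S j) (k : ℕ) : ℝ :=
  (1 / (i.choose k : ℝ)) *
    ∑ T ∈ Finset.powersetCard k (Finset.univ : Finset (Fin i)),
      shannonEntropy μ (fun ω (j : {x : Fin i // x ∈ T}) => X j.1 ω)


theorem han_finite {α β γ : Type*} [Fintype α] [Fintype β] [Fintype γ] [DecidableEq γ]
    (p : α → β → ℝ) (hp : ∀ u v, 0 ≤ p u v) (f : β → γ)
    (s : β → ℝ) (hs : ∀ v, s v = ∑ u, p u v)
    (q : α → γ → ℝ) (hq : ∀ u c, q u c = ∑ v, if f v = c then p u v else 0)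
    (r : γ → ℝ) (hr : ∀ c, r c = ∑ u, q u c) :
    (∑ u, ∑ c, q u c * log (q u c)) + ∑ v, s v * log (s v) ≤
      (∑ u, ∑ v, p u v * log (p u v)) + ∑ c, r c * log (r c) := by
  have hps : ∀ u v, p u v ≤ s v := fun u v => by
    rw [hs]; exact Finset.single_le_sum (f := fun u => p u v) (fun u _ => hp u v) (Finset.mem_univ u)
  have hq0 : ∀ u c, 0 ≤ q u c := fun u c => by
    rw [hq]; exact Finset.sum_nonneg fun v _ => by split_ifs <;> simp [hp]
  have hr0 : ∀ c, 0 ≤ r c := fun c => by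
    rw [hr]; exact Finset.sum_nonneg fun v _ => hq0 _ _
  have hs0 : ∀ v, 0 ≤ s v := fun c => by
    rw [hs]; exact Finset.sum_nonneg fun v _ => hp _ _
  have hpq : ∀ u v, p u v ≤ q u (f v) := fun u v => by
    rw [hq]
    have := Finset.single_le_sum (f := fun v' => if f v' = f v then p u v' else 0)
      (fun v' _ => by split_ifs <;> simp [hp]) (Finset.mem_univ v)
    simpa using this
  have hqr : ∀ u c, q u c ≤ r c := fun u v => by
    rw [hr]; exact Finset.single_le_sum (f := fun u => q u v) (fun u _ => hq0 u v) (Finset.mem_univ u)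
  have key : ∀ u v, p u v - q u (f v) * s v / r (f v) ≤
      p u v * log (p u v) + p u v * log (r (f v)) - p u v * log (q u (f v))
        - p u v * log (s v) := fun u v => by
    rcases (hp u v).eq_or_lt with h | h
    · rw [← h]
      have : 0 ≤ q u (f v) * s v / r (f v) :=
        div_nonneg (mul_nonneg (hq0 _ _) (hs0 _)) (hr0 _)
      simp only [zero_mul]; linarith
    · have h1 : 0 < s v := h.trans_le (hps u v)
      have h2 : 0 < q u (f v) := h.trans_le (hpq u v)
      have h3 : 0 < r (f v) := h2.trans_le (hqr _ _)
      have h4 := Real.log_le_sub_one_of_pos (x := q u (f v) * s v / (p u v * r (f v)))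
        (by positivity)
      rw [Real.log_div (by positivity) (by positivity), Real.log_mul h2.ne' h1.ne',
        Real.log_mul h.ne' h3.ne'] at h4
      have h5 := mul_le_mul_of_nonneg_left h4 h.le
      have h6 : p u v * (q u (f v) * s v / (p u v * r (f v)) - 1) =
        q u (f v) * s v / r (f v) - p u v := by field_simp
      rw [h6] at h5
      linarith
  have tot : ∑ u, ∑ v, q u (f v) * s v / r (f v) ≤ ∑ u, ∑ v, p u v := by
    rw [Finset.sum_comm, Finset.sum_comm (f := fun u v => p u v)]
    refine Finset.sum_le_sum fun v _ => ?_
    rw [← hs, ← Finset.sum_div, ← Finset.sum_mul, ← hr]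
    rcases (hr0 (f v)).eq_or_lt with h | h
    · rw [← h]; simpa using hs0 v
    · rw [mul_div_assoc, mul_div_cancel₀ _ h.ne']
  have e1 : ∑ u, ∑ v, p u v * log (s v) = ∑ v, s v * log (s v) := by
    rw [Finset.sum_comm]
    refine Finset.sum_congr rfl fun v _ => ?_
    rw [← Finset.sum_mul, ← hs]
  have e2 : ∀ u, ∀ g : γ → ℝ, ∑ v, p u v * g (f v) = ∑ c, q u c * g c := fun u g => by
    simp only [hq, Finset.sum_mul]
    rw [Finset.sum_comm]
    simp
  have e3 : ∑ u, ∑ v, p u v * log (r (f v)) = ∑ c, r c * log (r c) := by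
    simp only [e2 _ (fun c => log (r c))]
    rw [Finset.sum_comm]
    refine Finset.sum_congr rfl fun v _ => ?_
    rw [← Finset.sum_mul, ← hr]
  have e4 : ∑ u, ∑ v, p u v * log (q u (f v)) = ∑ u, ∑ c, q u c * log (q u c) :=
    Finset.sum_congr rfl fun u _ => e2 u (fun c => log (q u c))
  have := Finset.sum_le_sum fun u (_ : u ∈ Finset.univ) =>
    Finset.sum_le_sum fun v (_ : v ∈ Finset.univ) => key u v
  simp only [Finset.sum_sub_distrib, Finset.sum_add_distrib] at this
  linarith

theorem han_marginal {Ω : Type*} [MeasurableSpace Ω] (μ : Measure Ω) [IsProbabilityMeasure μ]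
    {α β : Type*} [Fintype α] [DecidableEq β] (W : Ω → α)
    (hW : ∀ a, MeasurableSet (W ⁻¹' {a})) (g : α → β) (b : β) :
    (μ ((fun ω => g (W ω)) ⁻¹' {b})).toReal =
      ∑ a, if g a = b then (μ (W ⁻¹' {a})).toReal else 0 := by
  classical
  rw [← Finset.sum_filter]
  have h : (fun ω => g (W ω)) ⁻¹' {b} = ⋃ a ∈ Finset.univ.filter (fun a => g a = b), W ⁻¹' {a} := by
    ext ω; simp
  rw [h, measure_biUnion_finset, ENNReal.toReal_sum]
  · intro a _; exact measure_ne_top _ _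
  · intro a _ a' _ hne
    refine Set.disjoint_left.2 fun ω h1 h2 => hne ?_
    simp only [Set.mem_preimage, Set.mem_singleton_iff] at h1 h2
    rw [← h1, ← h2]
  · intro a _; exact hW a

theorem han_injective {Ω : Type*} [MeasurableSpace Ω] (μ : Measure Ω)
    {α β : Type*} [Fintype α] [Fintype β] (W : Ω → α) (e : α → β) (he : e.Injective) :
    shannonEntropy μ (fun ω => e (W ω)) = shannonEntropy μ W := by
  classical
  unfold shannonEntropy
  congr 1
  symm
  refine Finset.sum_of_injOn e he.injOn (by simp) ?_ ?_
  · intro b _ hb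
    have : (fun ω => e (W ω)) ⁻¹' {b} = ∅ := by
      ext ω
      simp only [Set.mem_preimage, Set.mem_singleton_iff, Set.mem_empty_iff_false, iff_false]
      intro h
      exact hb ⟨W ω, by simp, h⟩
    simp [this]
  · intro a _
    have : (fun ω => e (W ω)) ⁻¹' {e a} = W ⁻¹' {a} := by
      ext ω; simp [he.eq_iff]
    rw [this]

theorem han_submod {Ω : Type*} [MeasurableSpace Ω] (μ : Measure Ω) [IsProbabilityMeasure μ]
    {α β γ : Type*} [Fintype α] [Fintype β] [Fintype γ] (U : Ω → α) (V : Ω → β) (f : β → γ)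
    (hU : ∀ a, MeasurableSet (U ⁻¹' {a})) (hV : ∀ a, MeasurableSet (V ⁻¹' {a})) :
    shannonEntropy μ (fun ω => (U ω, V ω)) + shannonEntropy μ (fun ω => f (V ω)) ≤
      shannonEntropy μ (fun ω => (U ω, f (V ω))) + shannonEntropy μ V := by
  classical
  have hW : ∀ a : α × β, MeasurableSet ((fun ω => (U ω, V ω)) ⁻¹' {a}) := by
    rintro ⟨a, b⟩
    have : (fun ω => (U ω, V ω)) ⁻¹' {(a, b)} = U ⁻¹' {a} ∩ V ⁻¹' {b} := by
      ext ω; simp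
    rw [this]; exact (hU a).inter (hV b)
  have m1 := han_marginal μ _ hW (fun x => x.2)
  have m2 := han_marginal μ _ hW (fun x => (x.1, f x.2))
  have m3 := han_marginal μ _ hW (fun x => f x.2)
  have := han_finite (fun u v => (μ ((fun ω => (U ω, V ω)) ⁻¹' {(u, v)})).toReal)
    (fun _ _ => ENNReal.toReal_nonneg) f
    (fun v => (μ (V ⁻¹' {v})).toReal) ?_
    (fun u c => (μ ((fun ω => (U ω, f (V ω))) ⁻¹' {(u, c)})).toReal) ?_
    (fun c => (μ ((fun ω => f (V ω)) ⁻¹' {c})).toReal) ?_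
  · unfold shannonEntropy
    rw [Fintype.sum_prod_type, Fintype.sum_prod_type]
    linarith
  · intro v
    refine (m1 v).trans ?_
    rw [Fintype.sum_prod_type]
    simp
  · intro u c
    refine (m2 (u, c)).trans ?_
    rw [Fintype.sum_prod_type, Finset.sum_eq_single u]
    · simp
    · intro u' _ h; simp [h]
    · simp
  · intro c
    refine (m3 c).trans ?_
    rw [Fintype.sum_prod_type]
    refine Finset.sum_congr rfl fun u _ => ?_
    refine Eq.symm ((m2 (u, c)).trans ?_)
    rw [Fintype.sum_prod_type, Finset.sum_eq_single u]
    · simp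
    · intro u' _ h; simp [h]
    · simp

theorem han_submod_sets {Ω : Type*} [MeasurableSpace Ω] (μ : Measure Ω) [IsProbabilityMeasure μ]
    {i : ℕ} {S : Fin i → Type*} [∀ j, Fintype (S j)]
    (X : ∀ j, Ω → S j) (hX : ∀ j s, MeasurableSet (X j ⁻¹' {s}))
    (h : Finset (Fin i) → ℝ)
    (hh : ∀ T, h T = shannonEntropy μ (fun ω (j : {x : Fin i // x ∈ T}) => X j.1 ω))
    (A B : Finset (Fin i)) (hAB : A ⊆ B) (a : Fin i) :
    h (insert a B) + h A ≤ h (insert a A) + h B := by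
  have hins : ∀ T : Finset (Fin i), h (insert a T) =
      shannonEntropy μ (fun ω => (X a ω, fun (j : {x : Fin i // x ∈ T}) => X j.1 ω)) := by
    intro T
    rw [hh]
    refine (han_injective μ (fun ω (j : {x : Fin i // x ∈ insert a T}) => X j.1 ω)
      (fun z => (z ⟨a, Finset.mem_insert_self a T⟩,
        fun (j : {x : Fin i // x ∈ T}) => z ⟨j.1, Finset.mem_insert_of_mem j.2⟩)) ?_).symm
    intro z z' hz
    simp only [Prod.mk.injEq] at hz
    funext ⟨j, hj⟩
    rcases Finset.mem_insert.1 hj with rfl | hj'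
    · exact hz.1
    · exact congrFun hz.2 ⟨j, hj'⟩
  rw [hins, hins, hh, hh]
  refine han_submod μ (X a) (fun ω (j : {x : Fin i // x ∈ B}) => X j.1 ω)
    (fun z (j : {x : Fin i // x ∈ A}) => z ⟨j.1, hAB j.2⟩) (hX a) ?_
  intro z
  have : (fun ω (j : {x : Fin i // x ∈ B}) => X j.1 ω) ⁻¹' {z} = ⋂ j, X j.1 ⁻¹' {z j} := by
    ext ω; simp [funext_iff]
  rw [this]
  exact MeasurableSet.iInter fun j => hX _ _

theorem han_local {ι : Type*} [DecidableEq ι] (h : Finset ι → ℝ) (h0 : h ∅ = 0)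
    (sub : ∀ A B : Finset ι, A ⊆ B → ∀ a, h (insert a B) + h A ≤ h (insert a A) + h B)
    (T : Finset ι) : ((T.card : ℝ) - 1) * h T ≤ ∑ j ∈ T, h (T.erase j) := by
  have : ∀ A : Finset ι, A ⊆ T → ∑ j ∈ A, (h T - h (T.erase j)) ≤ h A := by
    intro A
    induction A using Finset.induction_on with
    | empty => simp [h0]
    | insert a A ha ih =>
      intro hA
      have haT : a ∈ T := hA (Finset.mem_insert_self _ _)
      have hAT : A ⊆ T := fun x hx => hA (Finset.mem_insert_of_mem hx)
      have hs := sub A (T.erase a) (fun x hx => Finset.mem_erase.2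
        ⟨fun e => ha (e ▸ hx), hAT hx⟩) a
      rw [Finset.insert_erase haT] at hs
      rw [Finset.sum_insert ha]
      linarith [ih hAT]
  have := this T subset_rfl
  rw [Finset.sum_sub_distrib, Finset.sum_const, nsmul_eq_mul] at this
  linarith

theorem han_count {i : ℕ} (h : Finset (Fin i) → ℝ) (k : ℕ) :
    ∑ T ∈ Finset.powersetCard (k + 1) (Finset.univ : Finset (Fin i)), ∑ j ∈ T, h (T.erase j) =
      ((i - k : ℕ) : ℝ) * ∑ T ∈ Finset.powersetCard k (Finset.univ : Finset (Fin i)), h T := by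
  have : ((i - k : ℕ) : ℝ) * ∑ T ∈ Finset.powersetCard k (Finset.univ : Finset (Fin i)), h T =
      ∑ T ∈ Finset.powersetCard k (Finset.univ : Finset (Fin i)), ∑ j ∈ Tᶜ, h T := by
    rw [Finset.mul_sum]
    refine Finset.sum_congr rfl fun T hT => ?_
    rw [Finset.sum_const, nsmul_eq_mul, Finset.card_compl, (Finset.mem_powersetCard.1 hT).2,
      Fintype.card_fin]
  rw [this, Finset.sum_sigma', Finset.sum_sigma']
  refine Finset.sum_bij' (fun x _ => ⟨x.1.erase x.2, x.2⟩) (fun x _ => ⟨insert x.2 x.1, x.2⟩)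
    ?_ ?_ ?_ ?_ ?_
  · rintro ⟨T, j⟩ hx
    simp only [Finset.mem_sigma, Finset.mem_powersetCard, Finset.subset_univ, true_and] at hx ⊢
    simp [Finset.card_erase_of_mem hx.2, hx.1]
  · rintro ⟨T, j⟩ hx
    simp only [Finset.mem_sigma, Finset.mem_powersetCard, Finset.subset_univ, true_and,
      Finset.mem_compl] at hx ⊢
    simp [Finset.card_insert_of_notMem hx.2, hx.1]
  · rintro ⟨T, j⟩ hx
    simp only [Finset.mem_sigma] at hx
    simp [Finset.insert_erase hx.2]
  · rintro ⟨T, j⟩ hx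
    simp only [Finset.mem_sigma, Finset.mem_compl] at hx
    simp [Finset.erase_insert hx.2]
  · rintro ⟨T, j⟩ hx
    rfl

theorem han_step {Ω : Type*} [MeasurableSpace Ω] (μ : Measure Ω) [IsProbabilityMeasure μ]
    {i : ℕ} {S : Fin i → Type*} [∀ j, Fintype (S j)]
    (X : ∀ j, Ω → S j) (hX : ∀ j s, MeasurableSet (X j ⁻¹' {s}))
    {k : ℕ} (hk : 1 ≤ k) (hki : k + 1 ≤ i) :
    (1 / ((k + 1 : ℕ) : ℝ)) * avgEntropy μ X (k + 1) ≤ (1 / (k : ℝ)) * avgEntropy μ X k := by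
  obtain ⟨h, hh⟩ : ∃ h : Finset (Fin i) → ℝ, ∀ T, h T =
    shannonEntropy μ (fun ω (j : {x : Fin i // x ∈ T}) => X j.1 ω) := ⟨_, fun _ => rfl⟩
  have h0 : h ∅ = 0 := by
    rw [hh]
    unfold shannonEntropy
    rw [neg_eq_zero]
    refine Finset.sum_eq_zero fun s _ => ?_
    have : (fun ω (j : {x : Fin i // x ∈ (∅ : Finset (Fin i))}) => X j.1 ω) ⁻¹' {s}
        = Set.univ := by
      ext ω
      simp only [Set.mem_preimage, Set.mem_singleton_iff, Set.mem_univ, iff_true]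
      funext ⟨j, hj⟩
      simp at hj
    rw [this]; simp
  have loc := han_local h h0 (han_submod_sets μ X hX h hh)
  have main : (k : ℝ) * ∑ T ∈ Finset.powersetCard (k + 1) (Finset.univ : Finset (Fin i)), h T ≤
      ((i - k : ℕ) : ℝ) * ∑ T ∈ Finset.powersetCard k (Finset.univ : Finset (Fin i)), h T := by
    rw [← han_count, Finset.mul_sum]
    refine Finset.sum_le_sum fun T hT => ?_
    have := loc T
    rw [(Finset.mem_powersetCard.1 hT).2] at this
    simpa using this
  unfold avgEntropy
  simp only [← hh]
  have hc : ((i.choose (k + 1) : ℕ) : ℝ) * ((k + 1 : ℕ) : ℝ) = (i.choose k : ℝ) * ((i - k : ℕ) : ℝ) := by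
    exact_mod_cast Nat.choose_succ_right_eq i k
  have c1 : (0 : ℝ) < i.choose k := by exact_mod_cast Nat.choose_pos (by omega)
  have c3 : (0 : ℝ) < (i - k : ℕ) := by exact_mod_cast (by omega : 0 < i - k)
  have c4 : (0 : ℝ) < k := by exact_mod_cast hk
  rw [← mul_assoc, ← mul_assoc, one_div_mul_one_div, one_div_mul_one_div,
    mul_comm ((k + 1 : ℕ) : ℝ), hc, one_div_mul_eq_div, one_div_mul_eq_div,
    div_le_div_iff₀ (by positivity) (by positivity)]
  have := mul_le_mul_of_nonneg_left main c1.le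
  linarith

/-- Han's inequality (averaged form): `(1/k) * H̄^k(X)` is non-increasing in `k`. -/
theorem hans_inequality_averaged
    {Ω : Type*} [MeasurableSpace Ω] (μ : Measure Ω) [IsProbabilityMeasure μ]
    {i : ℕ} {S : Fin i → Type*} [∀ j, Fintype (S j)]
    (X : ∀ j, Ω → S j) (hX : ∀ j s, MeasurableSet (X j ⁻¹' {s}))
    {k m : ℕ} (hk : 1 ≤ k) (hkm : k ≤ m) (hmi : m ≤ i) :
    (1 / (m : ℝ)) * avgEntropy μ X m ≤ (1 / (k : ℝ)) * avgEntropy μ X k := by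

  induction m, hkm using Nat.le_induction with
  | base => exact le_rfl
  | succ n hn ih => exact (han_step μ X hX (hk.trans hn) hmi).trans (ih (by omega))
end

section
/- Conditional-entropy decomposition used in the proof of Han's inequality: Let X_1, ..., X_n (n ≥ 2) be discrete random variables on a probability space, each taking values in a finite set. Then for each index i, H(X_1, ..., X_n) = H(X_1, ..., X_{i-1}, X_{i+1}, ..., X_n) + H(X_i | X_1, ..., X_{i-1}, X_{i+1}, ..., X_n), and moreover H(X_i | X_1, ..., X_{i-1}, X_{i+1}, ..., X_n) ≤ H(X_i | X_1, ..., X_{i-1}), so that summing over i yields (n - 1) · H(X_1, ..., X_n) ≤ Σ_{i=1}^{n} H(X_1, ..., X_{i-1}, X_{i+1}, ..., X_n). -/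
open MeasureTheory Real

/-- Conditional entropy `H(X | Z) = H(X, Z) - H(Z)`. -/
noncomputable def condEntropy {Ω : Type*} [MeasurableSpace Ω] (μ : Measure Ω)
    {S T : Type*} [Fintype S] [Fintype T] (X : Ω → S) (Z : Ω → T) : ℝ :=
  shannonEntropy μ (fun ω => (X ω, Z ω)) - shannonEntropy μ Z

/-- Change of variables for finite sums against the law of `f ∘ W`. -/
lemma han_sum_comp {Ω : Type*} [MeasurableSpace Ω] (μ : Measure Ω) [IsProbabilityMeasure μ]
    {S T : Type*} [Fintype S] [Fintype T] (W : Ω → S) (hW : ∀ s, MeasurableSet (W ⁻¹' {s}))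
    (f : S → T) (F : T → ℝ) :
    ∑ t, (μ ((fun ω => f (W ω)) ⁻¹' {t})).toReal * F t
      = ∑ s, (μ (W ⁻¹' {s})).toReal * F (f s) := by
  classical
  have key : ∀ t, (μ ((fun ω => f (W ω)) ⁻¹' {t})).toReal
      = ∑ s, if f s = t then (μ (W ⁻¹' {s})).toReal else 0 := by
    intro t
    have h1 : (fun ω => f (W ω)) ⁻¹' {t}
        = ⋃ s ∈ Finset.univ.filter (fun s => f s = t), W ⁻¹' {s} := by
      ext ω; simp
    rw [h1, measure_biUnion_finset, ENNReal.toReal_sum, Finset.sum_filter]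
    · intro s _; exact measure_ne_top _ _
    · intro a _ b _ hab
      exact Disjoint.preimage _ (by simpa using hab)
    · intro s _; exact hW s
  simp_rw [key, Finset.sum_mul]
  rw [Finset.sum_comm]
  refine Finset.sum_congr rfl fun s _ => ?_
  simp [ite_mul]

lemma han_entropy_comp {Ω : Type*} [MeasurableSpace Ω] (μ : Measure Ω) [IsProbabilityMeasure μ]
    {S T : Type*} [Fintype S] [Fintype T] (W : Ω → S) (hW : ∀ s, MeasurableSet (W ⁻¹' {s}))
    (f : S → T) :
    shannonEntropy μ (fun ω => f (W ω)) = - ∑ s, (μ (W ⁻¹' {s})).toReal *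
      Real.log (μ ((fun ω => f (W ω)) ⁻¹' {f s})).toReal := by
  unfold shannonEntropy
  rw [han_sum_comp μ W hW f (fun t => Real.log (μ ((fun ω => f (W ω)) ⁻¹' {t})).toReal)]

lemma han_entropy_inj {Ω : Type*} [MeasurableSpace Ω] (μ : Measure Ω) [IsProbabilityMeasure μ]
    {S T : Type*} [Fintype S] [Fintype T] (W : Ω → S) (hW : ∀ s, MeasurableSet (W ⁻¹' {s}))
    (f : S → T) (hf : Function.Injective f) :
    shannonEntropy μ (fun ω => f (W ω)) = shannonEntropy μ W := by
  rw [han_entropy_comp μ W hW f]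
  unfold shannonEntropy
  congr 1
  refine Finset.sum_congr rfl fun s _ => ?_
  have : (fun ω => f (W ω)) ⁻¹' {f s} = W ⁻¹' {s} := by
    ext ω; simp [hf.eq_iff]
  rw [this]

lemma han_total {Ω : Type*} [MeasurableSpace Ω] (μ : Measure Ω) [IsProbabilityMeasure μ]
    {S : Type*} [Fintype S] (W : Ω → S) (hW : ∀ s, MeasurableSet (W ⁻¹' {s})) :
    ∑ s, (μ (W ⁻¹' {s})).toReal = 1 := by
  have h := han_sum_comp μ W hW (fun _ => ()) (fun _ => 1)
  simp at h
  exact h.symm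

/-- Conditioning on a function of `Z` rather than `Z` increases the conditional entropy. -/
lemma han_cond_mono {Ω : Type*} [MeasurableSpace Ω] (μ : Measure Ω) [IsProbabilityMeasure μ]
    {S T U : Type*} [Fintype S] [Fintype T] [Fintype U] (A : Ω → S) (Z : Ω → T) (g : T → U)
    (hA : ∀ s, MeasurableSet (A ⁻¹' {s})) (hZ : ∀ s, MeasurableSet (Z ⁻¹' {s})) :
    condEntropy μ A Z ≤ condEntropy μ A (fun ω => g (Z ω)) := by
  classical
  set W : Ω → S × T := fun ω => (A ω, Z ω) with hWdef
  have hW : ∀ s, MeasurableSet (W ⁻¹' {s}) := by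
    rintro ⟨a, z⟩
    have : W ⁻¹' {(a, z)} = A ⁻¹' {a} ∩ Z ⁻¹' {z} := by
      ext ω; simp [hWdef]
    rw [this]; exact (hA a).inter (hZ z)
  have e2 := han_entropy_comp μ W hW Prod.snd
  have e3 := han_entropy_comp μ W hW (fun w => (w.1, g w.2))
  have e4 := han_entropy_comp μ W hW (fun w => g w.2)
  have hZq := han_sum_comp μ W hW (fun w => (w.1, g w.2))
  simp only [hWdef] at e2 e3 e4
  unfold condEntropy
  rw [e2, e3, e4]
  unfold shannonEntropy
  set p : S × T → ℝ := fun w => (μ (W ⁻¹' {w})).toReal with hp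
  set pz : T → ℝ := fun z => (μ (Z ⁻¹' {z})).toReal with hpz
  set q : S × U → ℝ := fun w => (μ ((fun ω => (A ω, g (Z ω))) ⁻¹' {w})).toReal with hq
  set qu : U → ℝ := fun u => (μ ((fun ω => g (Z ω)) ⁻¹' {u})).toReal with hqu
  change (-∑ w, p w * Real.log (p w)) - (-∑ w, p w * Real.log (pz w.2)) ≤
    (-∑ w, p w * Real.log (q (w.1, g w.2))) - (-∑ w, p w * Real.log (qu (g w.2)))
  have p0 : ∀ w, 0 ≤ p w := fun w => ENNReal.toReal_nonneg
  have pz0 : ∀ w, 0 ≤ pz w := fun w => ENNReal.toReal_nonneg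
  have q0 : ∀ w, 0 ≤ q w := fun w => ENNReal.toReal_nonneg
  have qu0 : ∀ w, 0 ≤ qu w := fun w => ENNReal.toReal_nonneg
  have m1 : ∀ w, p w ≤ pz w.2 := fun w =>
    ENNReal.toReal_mono (measure_ne_top _ _) (measure_mono (by
      intro ω h; simp [hWdef] at h ⊢; rw [← h]))
  have m2 : ∀ w, p w ≤ q (w.1, g w.2) := fun w =>
    ENNReal.toReal_mono (measure_ne_top _ _) (measure_mono (by
      intro ω h; simp [hWdef] at h ⊢; rw [← h]; simp))
  have m3 : ∀ w, p w ≤ qu (g w.2) := fun w =>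
    ENNReal.toReal_mono (measure_ne_top _ _) (measure_mono (by
      intro ω h; simp [hWdef] at h ⊢; rw [← h]))
  have tp : ∑ w, p w = 1 := han_total μ W hW
  have tz : ∑ z, pz z = 1 := han_total μ Z hZ
  -- marginal of q
  have mq : ∀ u, ∑ a, q (a, u) = qu u := by
    intro u
    have hQ : ∀ w, MeasurableSet ((fun ω => (A ω, g (Z ω))) ⁻¹' {w}) := by
      rintro ⟨a, v⟩
      have : (fun ω => (A ω, g (Z ω))) ⁻¹' {(a, v)}
          = ⋃ z ∈ Finset.univ.filter (fun z => g z = v), W ⁻¹' {(a, z)} := by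
        ext ω; simp [hWdef]
      rw [this]
      exact Finset.measurableSet_biUnion _ fun z _ => hW _
    have h := han_sum_comp μ (fun ω => (A ω, g (Z ω))) hQ Prod.snd
      (fun v => if v = u then 1 else 0)
    simp only [mul_ite, mul_one, mul_zero, Finset.sum_ite_eq', Finset.mem_univ, if_true,
      Fintype.sum_prod_type] at h
    exact h.symm
  have term : ∀ w, p w * (Real.log (pz w.2) + Real.log (q (w.1, g w.2)) - Real.log (p w)
      - Real.log (qu (g w.2))) ≤ pz w.2 * (q (w.1, g w.2) / qu (g w.2)) - p w := by
    intro w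
    rcases (p0 w).eq_or_lt with h | h
    · rw [← h]
      have := mul_nonneg (pz0 w.2) (div_nonneg (q0 (w.1, g w.2)) (qu0 (g w.2)))
      linarith
    · have h1 := h.trans_le (m1 w)
      have h2 := h.trans_le (m2 w)
      have h3 := h.trans_le (m3 w)
      have hl : Real.log (pz w.2) + Real.log (q (w.1, g w.2)) - Real.log (p w)
          - Real.log (qu (g w.2))
          = Real.log (pz w.2 * q (w.1, g w.2) / p w / qu (g w.2)) := by
        rw [Real.log_div (by positivity) (by positivity),
          Real.log_div (by positivity) (by positivity),
          Real.log_mul (by positivity) (by positivity)]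
      rw [hl]
      have := Real.log_le_sub_one_of_pos
        (show 0 < pz w.2 * q (w.1, g w.2) / p w / qu (g w.2) by positivity)
      calc _ ≤ p w * (pz w.2 * q (w.1, g w.2) / p w / qu (g w.2) - 1) :=
            mul_le_mul_of_nonneg_left this h.le
        _ = _ := by field_simp
  have hs := Finset.sum_le_sum (fun w (_ : w ∈ Finset.univ) => term w)
  have hb : ∑ w : S × T, pz w.2 * (q (w.1, g w.2) / qu (g w.2)) ≤ 1 := by
    rw [Fintype.sum_prod_type_right, ← tz]
    refine Finset.sum_le_sum fun z _ => ?_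
    simp only
    rw [← Finset.mul_sum, ← Finset.sum_div, mq]
    exact mul_le_of_le_one_right (pz0 z) (div_self_le_one _)
  rw [Finset.sum_sub_distrib, tp] at hs
  simp only [mul_sub, mul_add, Finset.sum_sub_distrib, Finset.sum_add_distrib] at hs
  linarith

/-- Conditional-entropy decomposition used in the proof of Han's inequality:
`H(X_1, …, X_n) = H(X_{≠ i}) + H(X_i | X_{≠ i})`, conditioning on fewer variables
(the prefix `X_1, …, X_{i-1}`) increases conditional entropy, and summing over `i`
gives `(n - 1) * H(X_1, …, X_n) ≤ ∑ i, H(X_{≠ i})`. -/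
theorem hans_conditional_entropy_decomposition
    {Ω : Type*} [MeasurableSpace Ω] (μ : Measure Ω) [IsProbabilityMeasure μ]
    {n : ℕ} (hn : 2 ≤ n) {S : Fin n → Type*} [∀ i, Fintype (S i)]
    (X : ∀ i, Ω → S i) (hX : ∀ i s, MeasurableSet (X i ⁻¹' {s})) :
    (∀ i : Fin n,
        shannonEntropy μ (fun ω (j : Fin n) => X j ω) =
          shannonEntropy μ (fun ω (j : {j : Fin n // j ≠ i}) => X j.1 ω) +
            condEntropy μ (X i) (fun ω (j : {j : Fin n // j ≠ i}) => X j.1 ω)) ∧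
      (∀ i : Fin n,
        condEntropy μ (X i) (fun ω (j : {j : Fin n // j ≠ i}) => X j.1 ω) ≤
          condEntropy μ (X i) (fun ω (j : {j : Fin n // j.1 < i.1}) => X j.1 ω)) ∧
      (n - 1 : ℝ) * shannonEntropy μ (fun ω (j : Fin n) => X j ω) ≤
        ∑ i : Fin n, shannonEntropy μ (fun ω (j : {j : Fin n // j ≠ i}) => X j.1 ω) := by
  have meas : ∀ (P : Fin n → Prop) [DecidablePred P] (w : ∀ j : {j // P j}, S j.1),
      MeasurableSet ((fun ω (j : {j : Fin n // P j}) => X j.1 ω) ⁻¹' {w}) := by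
    intro P _ w
    have : (fun ω (j : {j : Fin n // P j}) => X j.1 ω) ⁻¹' {w}
        = ⋂ j : {j // P j}, X j.1 ⁻¹' {w j} := by
      ext ω; simp [funext_iff]
    rw [this]
    exact MeasurableSet.iInter fun j => hX _ _
  have measAll : ∀ w : (∀ j, S j),
      MeasurableSet ((fun ω (j : Fin n) => X j ω) ⁻¹' {w}) := by
    intro w
    have : (fun ω (j : Fin n) => X j ω) ⁻¹' {w} = ⋂ j, X j ⁻¹' {w j} := by
      ext ω; simp [funext_iff]
    rw [this]
    exact MeasurableSet.iInter fun j => hX _ _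
  have part1 : ∀ i : Fin n,
        shannonEntropy μ (fun ω (j : Fin n) => X j ω) =
          shannonEntropy μ (fun ω (j : {j : Fin n // j ≠ i}) => X j.1 ω) +
            condEntropy μ (X i) (fun ω (j : {j : Fin n // j ≠ i}) => X j.1 ω) := by
    intro i
    have h := han_entropy_inj μ (fun ω (j : Fin n) => X j ω) measAll
      (fun w => (w i, fun j : {j : Fin n // j ≠ i} => w j.1)) (by
        intro a b hab
        simp only [Prod.mk.injEq] at hab
        funext j
        by_cases hj : j = i
        · subst hj; exact hab.1
        · exact congrFun hab.2 ⟨j, hj⟩)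
    unfold condEntropy
    rw [← h]; ring
  have part2 : ∀ i : Fin n,
        condEntropy μ (X i) (fun ω (j : {j : Fin n // j ≠ i}) => X j.1 ω) ≤
          condEntropy μ (X i) (fun ω (j : {j : Fin n // j.1 < i.1}) => X j.1 ω) := by
    intro i
    have hne : ∀ j : {j : Fin n // j.1 < i.1}, j.1 ≠ i := fun j hj => by
      have h2 := j.2
      rw [hj] at h2
      exact lt_irrefl _ h2
    have hm : ∀ w, MeasurableSet ((fun ω (j : {j : Fin n // j ≠ i}) => X j.1 ω) ⁻¹' {w}) :=
      meas (fun j => j ≠ i)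
    have h := han_cond_mono μ (X i) (fun ω (j : {j : Fin n // j ≠ i}) => X j.1 ω)
      (fun w (j : {j : Fin n // j.1 < i.1}) => w ⟨j.1, hne j⟩)
      (hX i) hm
    exact h
  refine ⟨part1, part2, ?_⟩
  let h : ℕ → ℝ := fun k => shannonEntropy μ (fun ω (j : {j : Fin n // j.1 < k}) => X j.1 ω)
  have hc : ∀ i : Fin n,
      condEntropy μ (X i) (fun ω (j : {j : Fin n // j.1 < i.1}) => X j.1 ω)
        = h (i.1 + 1) - h i.1 := by
    intro i
    have e := han_entropy_inj μ (fun ω (j : {j : Fin n // j.1 < i.1 + 1}) => X j.1 ω)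
      (meas (fun j => j.1 < i.1 + 1))
      (fun w => (w ⟨i, Nat.lt_succ_self _⟩,
        fun j : {j : Fin n // j.1 < i.1} => w ⟨j.1, Nat.lt_succ_of_lt j.2⟩)) (by
        intro a b hab
        simp only [Prod.mk.injEq] at hab
        funext ⟨j, hj⟩
        by_cases hji : j = i
        · subst hji; exact hab.1
        · exact congrFun hab.2 ⟨j, by
            have : j.1 ≠ i.1 := fun h => hji (Fin.ext h)
            omega⟩)
    unfold condEntropy
    simp only [h]
    rw [← e]
  have h0 : h 0 = 0 := by
    have hu : ∀ s : (∀ j : {j : Fin n // j.1 < 0}, S j.1),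
        (fun ω (j : {j : Fin n // j.1 < 0}) => X j.1 ω) ⁻¹' {s} = Set.univ := by
      intro s; ext ω
      simp only [Set.mem_preimage, Set.mem_singleton_iff, Set.mem_univ, iff_true]
      funext j; exact absurd j.2 (Nat.not_lt_zero _)
    simp only [h, shannonEntropy, hu]
    simp
  have hN : h n = shannonEntropy μ (fun ω (j : Fin n) => X j ω) :=
    han_entropy_inj μ (fun ω (j : Fin n) => X j ω) measAll
      (fun w (j : {j : Fin n // j.1 < n}) => w j.1) (by
        intro a b hab
        funext j
        exact congrFun hab ⟨j, j.2⟩)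
  have tel : ∑ i : Fin n, (h (i.1 + 1) - h i.1) = h n := by
    rw [Fin.sum_univ_eq_sum_range (fun k => h (k + 1) - h k), Finset.sum_range_sub, h0, sub_zero]
  have hs := Finset.sum_le_sum (fun i (_ : i ∈ Finset.univ) => part2 i)
  simp only [hc] at hs
  rw [tel, hN] at hs
  have ht := Finset.sum_congr rfl (fun i (_ : i ∈ Finset.univ) => part1 i)
  rw [Finset.sum_add_distrib, Finset.sum_const, Finset.card_univ, Fintype.card_fin,
    nsmul_eq_mul] at ht
  linarith
end
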